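/- Let ρ = (ρ_1,…,ρ_m) and τ = (τ_1,…,τ_n) have all entries in (0,1), and suppose there exist positive integers p and q such that the p-th iteration of ρ equals the q-th iteration of τ as multisets. Then every dust-like self-similar set E ⊆ ℝ^d with contraction vector ρ is Lipschitz equivalent to every dust-like self-similar set F ⊆ ℝ^{d'} with contraction vector τ. -/

import Mathlib

open scoped BigOperators

noncomputable section

/-- `E ⊆ ℝ^d` is a dust-like self-similar set with contraction vector `ρ`:
`E` is nonempty compact, each `ρ j ∈ (0,1)`, and there are similarities `φ j`
with ratios `ρ j` such that `E = ⋃ j, φ j '' E` is a disjoint union. -/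
def IsDustLike {d : ℕ} {ι : Type} [Fintype ι]
    (E : Set (EuclideanSpace ℝ (Fin d))) (ρ : ι → ℝ) : Prop :=
  IsCompact E ∧ E.Nonempty ∧ (∀ j, ρ j ∈ Set.Ioo (0 : ℝ) 1) ∧
  ∃ φ : ι → EuclideanSpace ℝ (Fin d) → EuclideanSpace ℝ (Fin d),
    (∀ j x y, dist (φ j x) (φ j y) = ρ j * dist x y) ∧
    E = ⋃ j, φ j '' E ∧
    Pairwise fun j k => Disjoint (φ j '' E) (φ k '' E)

/-- `E` and `F` are Lipschitz equivalent: there is a bi-Lipschitz bijection between them. -/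
def LipEquiv {d d' : ℕ} (E : Set (EuclideanSpace ℝ (Fin d)))
    (F : Set (EuclideanSpace ℝ (Fin d'))) : Prop :=
  ∃ f : E → F, Function.Bijective f ∧ ∃ C : ℝ, 0 < C ∧ ∀ x y : E,
    C⁻¹ * dist (x : EuclideanSpace ℝ (Fin d)) (y : EuclideanSpace ℝ (Fin d))
      ≤ dist (f x : EuclideanSpace ℝ (Fin d')) (f y : EuclideanSpace ℝ (Fin d')) ∧
    dist (f x : EuclideanSpace ℝ (Fin d')) (f y : EuclideanSpace ℝ (Fin d'))
      ≤ C * dist (x : EuclideanSpace ℝ (Fin d)) (y : EuclideanSpace ℝ (Fin d))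

/-- The `p`-th iteration of `ρ = (ρ_1,…,ρ_m)` as a multiset:
`{ ρ_{i_1}·…·ρ_{i_p} : (i_1,…,i_p) ∈ {1,…,m}^p }` with multiplicities counted. -/
def iterMS {m : ℕ} (ρ : Fin m → ℝ) (p : ℕ) : Multiset ℝ :=
  Finset.univ.val.map fun f : Fin p → Fin m => ∏ t, ρ (f t)

theorem exists_equiv_of_map_eq {α β γ : Type} [Fintype α] [Fintype β] (f : α → γ) (g : β → γ)
    (h : (Finset.univ : Finset α).val.map f = (Finset.univ : Finset β).val.map g) :
    ∃ e : α ≃ β, ∀ a, g (e a) = f a := by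
  classical
  have key : ∀ c, Nonempty ({ a // f a = c } ≃ { b // g b = c }) := by
    intro c
    refine ⟨Fintype.equivOfCardEq ?_⟩
    have h1 := congrArg (Multiset.count c) h
    rw [Multiset.count_map, Multiset.count_map] at h1
    rw [Fintype.card_subtype, Fintype.card_subtype]
    simp only [eq_comm (a := c)] at h1
    exact h1
  exact ⟨Equiv.ofFiberEquiv fun c => (key c).some, fun a => Equiv.ofFiberEquiv_map _ a⟩

theorem IsDustLike.reindex {d : ℕ} {ι κ : Type} [Fintype ι] [Fintype κ]
    {E : Set (EuclideanSpace ℝ (Fin d))} {ρ : ι → ℝ} (h : IsDustLike E ρ) (e : κ ≃ ι) :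
    IsDustLike E (fun k => ρ (e k)) := by
  obtain ⟨hc, hn, hr, φ, h1, h2, h3⟩ := h
  refine ⟨hc, hn, fun j => hr _, fun k => φ (e k), fun j => h1 _, ?_, ?_⟩
  · rw [e.surjective.iUnion_comp (fun j => φ j '' E)]
    exact h2
  · intro j k hjk
    exact h3 (e.injective.ne hjk)

theorem ifs_iterate {X : Type} [MetricSpace X] {ι : Type} (E : Set X) (ρ : ι → ℝ)
    (hr : ∀ j, 0 < ρ j) (φ : ι → X → X)
    (h1 : ∀ j x y, dist (φ j x) (φ j y) = ρ j * dist x y)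
    (h2 : E = ⋃ j, φ j '' E)
    (h3 : Pairwise fun j k => Disjoint (φ j '' E) (φ k '' E)) (p : ℕ) :
    ∃ ψ : (Fin p → ι) → X → X,
      (∀ f x y, dist (ψ f x) (ψ f y) = (∏ t, ρ (f t)) * dist x y) ∧
      E = (⋃ f, ψ f '' E) ∧
      Pairwise fun f g => Disjoint (ψ f '' E) (ψ g '' E) := by
  induction p with
  | zero =>
    refine ⟨fun _ x => x, by simp, by simp [Set.iUnion_const], ?_⟩
    intro f g hfg
    exact absurd (Subsingleton.elim f g) hfg
  | succ p ih =>
    obtain ⟨ψ, k1, k2, k3⟩ := ih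
    have hinj : ∀ j, Function.Injective (φ j) := by
      intro j x y hxy
      have := h1 j x y
      rw [hxy, dist_self] at this
      have h := (mul_eq_zero.mp this.symm).resolve_left (hr j).ne'
      exact dist_eq_zero.mp h
    have hsub : ∀ g, ψ g '' E ⊆ E := by
      intro g
      conv_rhs => rw [k2]
      exact Set.subset_iUnion (fun g => ψ g '' E) g
    refine ⟨fun f x => φ (f 0) (ψ (Fin.tail f) x), ?_, ?_, ?_⟩
    · intro f x y
      rw [h1, k1, Fin.prod_univ_succ, mul_assoc]
      rfl
    · apply Set.Subset.antisymm
      · intro x hx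
        rw [h2] at hx
        obtain ⟨j, y, hy, rfl⟩ := Set.mem_iUnion.mp hx
        rw [k2] at hy
        obtain ⟨g, z, hz, rfl⟩ := Set.mem_iUnion.mp hy
        refine Set.mem_iUnion.mpr ⟨Fin.cons j g, z, hz, ?_⟩
        simp
      · intro x hx
        obtain ⟨f, z, hz, rfl⟩ := Set.mem_iUnion.mp hx
        rw [h2]
        exact Set.mem_iUnion.mpr ⟨f 0, _, hsub _ ⟨z, hz, rfl⟩, rfl⟩
    · intro f g hfg
      rw [Set.disjoint_left]
      rintro x ⟨y, hy, rfl⟩ ⟨z, hz, hzy⟩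
      by_cases h0 : f 0 = g 0
      · have ht : Fin.tail f ≠ Fin.tail g := by
          intro ht
          apply hfg
          rw [← Fin.cons_self_tail f, ← Fin.cons_self_tail g, h0, ht]
        simp only [h0] at hzy
        have := hinj _ hzy
        exact Set.disjoint_left.mp (k3 ht) ⟨y, hy, rfl⟩ ⟨z, hz, this⟩
      · exact Set.disjoint_left.mp (h3 h0) ⟨_, hsub _ ⟨y, hy, rfl⟩, rfl⟩
          ⟨_, hsub _ ⟨z, hz, rfl⟩, hzy⟩

theorem IsDustLike.iterate {d : ℕ} {ι : Type} [Fintype ι]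
    {E : Set (EuclideanSpace ℝ (Fin d))} {ρ : ι → ℝ} (h : IsDustLike E ρ) {p : ℕ} (hp : 0 < p) :
    IsDustLike E (fun f : Fin p → ι => ∏ t, ρ (f t)) := by
  obtain ⟨hc, hn, hr, φ, h1, h2, h3⟩ := h
  refine ⟨hc, hn, fun f => ⟨Finset.prod_pos fun t _ => (hr _).1, ?_⟩,
    ifs_iterate E ρ (fun j => (hr j).1) φ h1 h2 h3 p⟩
  obtain ⟨p, rfl⟩ := Nat.exists_eq_succ_of_ne_zero hp.ne'
  change ∏ t, ρ (f t) < 1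
  rw [Fin.prod_univ_succ]
  have h4 : ∏ t : Fin p, ρ (f t.succ) ≤ 1 :=
    Finset.prod_le_one (fun t _ => (hr _).1.le) (fun t _ => (hr _).2.le)
  have h5 := hr (f 0)
  nlinarith [h5.1, h5.2]

/-- Cylinder sets. -/
def cyl {X ι : Type} (E : Set X) (φ : ι → X → X) : ℕ → (ℕ → ι) → Set X
  | 0, _ => E
  | n + 1, a => φ (a 0) '' cyl E φ n (fun k => a (k + 1))

theorem coding {d : ℕ} {ι : Type} [Fintype ι]
    {E : Set (EuclideanSpace ℝ (Fin d))} {ρ : ι → ℝ} (h : IsDustLike E ρ) :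
    ∃ a : E → ℕ → ι, Function.Bijective a ∧ ∃ c C : ℝ, 0 < c ∧ 0 < C ∧
      ∀ (x y : E) (n : ℕ), (∀ k < n, a x k = a y k) → a x n ≠ a y n →
        c * ∏ k ∈ Finset.range n, ρ (a x k) ≤ dist x y ∧
        dist x y ≤ C * ∏ k ∈ Finset.range n, ρ (a x k) := by
  classical
  obtain ⟨hc, hn, hr, φ, h1, h2, h3⟩ := h
  have hinj : ∀ j, Function.Injective (φ j) := by
    intro j x y hxy
    have := h1 j x y
    rw [hxy, dist_self] at this
    have h := (mul_eq_zero.mp this.symm).resolve_left (hr j).1.ne'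
    exact dist_eq_zero.mp h
  have hcont : ∀ j, Continuous (φ j) := by
    intro j
    exact (LipschitzWith.of_dist_le_mul (K := ⟨ρ j, (hr j).1.le⟩)
      fun x y => (h1 j x y).le).continuous
  have hsub : ∀ j, φ j '' E ⊆ E := by
    intro j
    conv_rhs => rw [h2]
    exact Set.subset_iUnion (fun g => φ g '' E) j
  have hex : ∀ x : E, ∃ j, ∃ y : E, φ j y = x := by
    intro x
    obtain ⟨j, y, hy, hyx⟩ := Set.mem_iUnion.mp (h2.subset x.2)
    exact ⟨j, ⟨y, hy⟩, hyx⟩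
  choose i T hT using hex
  have hi : ∀ (x : E) j (y : E), φ j y = x → i x = j ∧ T x = y := by
    intro x j y hxy
    have hij : i x = j := by
      by_contra hne
      exact Set.disjoint_left.mp (h3 hne) ⟨_, (T x).2, hT x⟩ ⟨_, y.2, hxy⟩
    refine ⟨hij, Subtype.ext (hinj j ?_)⟩
    rw [hxy, ← hij, hT]
  haveI : Nonempty ι := ⟨i ⟨_, hn.some_mem⟩⟩
  -- separation
  have hsep : ∀ p : ι × ι, ∃ δ : ℝ, 0 < δ ∧
      (p.1 ≠ p.2 → ∀ x ∈ φ p.1 '' E, ∀ y ∈ φ p.2 '' E, δ ≤ dist x y) := by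
    intro p
    by_cases hp : p.1 = p.2
    · exact ⟨1, one_pos, fun h => absurd hp h⟩
    · obtain ⟨δ, hδ, hd⟩ := (h3 hp).exists_thickenings (hc.image (hcont _))
        (hc.image (hcont _)).isClosed
      refine ⟨δ, hδ, fun _ x hx y hy => ?_⟩
      by_contra hlt
      push Not at hlt
      exact Set.disjoint_left.mp hd (Metric.self_subset_thickening hδ _ hx)
        (Metric.mem_thickening_iff.mpr ⟨y, hy, hlt⟩)
  choose δ hδ0 hδ using hsep
  obtain ⟨p0, hp0⟩ := Finite.exists_min δ
  obtain ⟨q0, hq0⟩ := Finite.exists_max ρ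
  have hdist : ∀ (x y : E) (n : ℕ), (∀ k < n, i (T^[k] x) = i (T^[k] y)) →
      dist x y = (∏ k ∈ Finset.range n, ρ (i (T^[k] x))) * dist (T^[n] x) (T^[n] y) := by
    intro x y n
    induction n with
    | zero => intro _; simp
    | succ n ih =>
      intro hk
      rw [ih fun k hkn => hk k (by omega), Finset.prod_range_succ, mul_assoc]
      congr 1
      rw [Function.iterate_succ_apply', Function.iterate_succ_apply']
      have hx := hT (T^[n] x)
      have hy := hT (T^[n] y)
      rw [← hk n (by omega)] at hy
      rw [Subtype.dist_eq, ← hx, ← hy, h1]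
      rfl
  have hdiam : ∀ x y : E, dist x y ≤ Metric.diam E + 1 := by
    intro x y
    have := Metric.dist_le_diam_of_mem hc.isBounded x.2 y.2
    rw [Subtype.dist_eq]
    linarith
  have hprod : ∀ (b : ℕ → ι) n, 0 < ∏ k ∈ Finset.range n, ρ (b k) := fun b n =>
    Finset.prod_pos fun k _ => (hr _).1
  have hD : 0 < Metric.diam E + 1 := by
    have := Metric.diam_nonneg (s := E)
    linarith
  refine ⟨fun x k => i (T^[k] x), ⟨?_, ?_⟩, δ p0, Metric.diam E + 1, hδ0 _, hD, ?_⟩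
  · intro x y hxy
    have hxy' : ∀ k, i (T^[k] x) = i (T^[k] y) := fun k => congrFun hxy k
    have hle : ∀ n : ℕ, dist x y ≤ (ρ q0) ^ n * (Metric.diam E + 1) := by
      intro n
      rw [hdist x y n fun k _ => hxy' k]
      refine mul_le_mul ?_ (hdiam _ _) dist_nonneg (pow_nonneg (hr q0).1.le _)
      calc _ ≤ ∏ k ∈ Finset.range n, ρ q0 :=
            Finset.prod_le_prod (fun k _ => (hr _).1.le) (fun k _ => hq0 _)
        _ = _ := by simp
    have hlim : Filter.Tendsto (fun n : ℕ => (ρ q0) ^ n * (Metric.diam E + 1)) Filter.atTop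
        (nhds (0 * (Metric.diam E + 1))) :=
      (tendsto_pow_atTop_nhds_zero_of_lt_one (hr q0).1.le (hr q0).2).mul_const _
    rw [zero_mul] at hlim
    exact dist_le_zero.mp (ge_of_tendsto' hlim hle)
  · intro b
    have c1 : ∀ n b, IsCompact (cyl E φ n b) := by
      intro n
      induction n with
      | zero => intro b; exact hc
      | succ n ih => intro b; exact (ih _).image (hcont _)
    have c2 : ∀ n b, (cyl E φ n b).Nonempty := by
      intro n
      induction n with
      | zero => intro b; exact hn
      | succ n ih => intro b; exact (ih _).image _
    have c3 : ∀ n b, cyl E φ (n + 1) b ⊆ cyl E φ n b := by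
      intro n
      induction n with
      | zero => intro b; exact hsub _
      | succ n ih => intro b; exact Set.image_mono (ih _)
    have c5 : ∀ n b, cyl E φ n b ⊆ E := by
      intro n
      induction n with
      | zero => intro b; exact subset_rfl
      | succ n ih => intro b; exact (c3 n b).trans (ih b)
    have c4 : ∀ n b (x : E), (x : EuclideanSpace ℝ (Fin d)) ∈ cyl E φ n b →
        ∀ k < n, i (T^[k] x) = b k := by
      intro n
      induction n with
      | zero => intro b x _ k hk; omega
      | succ n ih =>
        rintro b x ⟨y, hy, hyx⟩ k hk
        obtain ⟨e1, e2⟩ := hi x (b 0) ⟨y, c5 _ _ hy⟩ hyx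
        cases k with
        | zero => exact e1
        | succ k =>
          rw [Function.iterate_succ_apply, e2]
          exact ih _ ⟨y, c5 _ _ hy⟩ hy k (by omega)
    obtain ⟨x, hx⟩ := IsCompact.nonempty_iInter_of_sequence_nonempty_isCompact_isClosed
      (fun n => cyl E φ n b) (fun n => c3 n b) (fun n => c2 n b) (c1 0 b)
      (fun n => (c1 n b).isClosed)
    rw [Set.mem_iInter] at hx
    refine ⟨⟨x, hx 0⟩, funext fun k => ?_⟩
    exact c4 (k + 1) b ⟨x, hx 0⟩ (hx (k + 1)) k (by omega)
  · intro x y n hk hne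
    have hk' : ∀ k < n, i (T^[k] x) = i (T^[k] y) := hk
    have hd := hdist x y n hk'
    have hp := hprod (fun k => i (T^[k] x)) n
    have hlow : δ p0 ≤ dist (T^[n] x) (T^[n] y) :=
      (hp0 _).trans (hδ (i (T^[n] x), i (T^[n] y)) hne _ ⟨_, (T (T^[n] x)).2, hT _⟩
        _ ⟨_, (T (T^[n] y)).2, hT _⟩)
    have hup := hdiam (T^[n] x) (T^[n] y)
    rw [hd]
    constructor
    · rw [mul_comm]
      exact mul_le_mul_of_nonneg_left hlow hp.le
    · rw [mul_comm]
      exact mul_le_mul_of_nonneg_right hup hp.le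

theorem lipEquiv_of_same {d d' : ℕ} {ι : Type} [Fintype ι]
    {E : Set (EuclideanSpace ℝ (Fin d))} {F : Set (EuclideanSpace ℝ (Fin d'))} {ρ : ι → ℝ}
    (hE : IsDustLike E ρ) (hF : IsDustLike F ρ) : LipEquiv E F := by
  classical
  have hr := hE.2.2.1
  obtain ⟨a, ha, c, C, hc, hC, h1⟩ := coding hE
  obtain ⟨b, hb, c', C', hc', hC', h2⟩ := coding hF
  let f : E ≃ F := (Equiv.ofBijective a ha).trans (Equiv.ofBijective b hb).symm
  have hf : ∀ x, b (f x) = a x := fun x => (Equiv.ofBijective b hb).apply_symm_apply _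
  have hA : 0 < C / c' := div_pos hC hc'
  have hB : 0 < C' / c := div_pos hC' hc
  refine ⟨f, f.bijective, C / c' + C' / c, by positivity, fun x y => ?_⟩
  change _ * dist x y ≤ dist (f x) (f y) ∧ dist (f x) (f y) ≤ _ * dist x y
  by_cases hxy : x = y
  · subst hxy; simp
  have hne : ∃ n, a x n ≠ a y n := by
    by_contra hcon
    push Not at hcon
    exact hxy (ha.1 (funext hcon))
  have hlt : ∀ k < Nat.find hne, a x k = a y k := fun k hk => not_not.mp (Nat.find_min hne hk)
  obtain ⟨u1, u2⟩ := h1 x y _ hlt (Nat.find_spec hne)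
  obtain ⟨v1, v2⟩ := h2 (f x) (f y) (Nat.find hne)
    (by rw [hf, hf]; exact hlt) (by rw [hf, hf]; exact Nat.find_spec hne)
  rw [hf] at v1 v2
  set P := ∏ k ∈ Finset.range (Nat.find hne), ρ (a x k)
  have e1 : dist x y ≤ C / c' * dist (f x) (f y) := by
    calc dist x y ≤ C * P := u2
      _ = C / c' * (c' * P) := by field_simp
      _ ≤ _ := mul_le_mul_of_nonneg_left v1 hA.le
  have e2 : dist (f x) (f y) ≤ C' / c * dist x y := by
    calc dist (f x) (f y) ≤ C' * P := v2
      _ = C' / c * (c * P) := by field_simp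
      _ ≤ _ := mul_le_mul_of_nonneg_left u1 hB.le
  have d1 := dist_nonneg (x := x) (y := y)
  have d2 := dist_nonneg (x := f x) (y := f y)
  constructor
  · rw [inv_mul_le_iff₀ (by positivity)]
    nlinarith
  · nlinarith

theorem stmt9 {d d' m n : ℕ} (ρ : Fin m → ℝ) (τ : Fin n → ℝ)
    (hρ : ∀ i, ρ i ∈ Set.Ioo (0 : ℝ) 1) (hτ : ∀ k, τ k ∈ Set.Ioo (0 : ℝ) 1)
    (h : ∃ p q : ℕ, 0 < p ∧ 0 < q ∧ iterMS ρ p = iterMS τ q)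
    (E : Set (EuclideanSpace ℝ (Fin d))) (F : Set (EuclideanSpace ℝ (Fin d')))
    (hE : IsDustLike E ρ) (hF : IsDustLike F τ) :
    LipEquiv E F := by
  obtain ⟨p, q, hp, hq, hpq⟩ := h
  obtain ⟨e, he⟩ := exists_equiv_of_map_eq _ _ hpq
  have hE' := hE.iterate hp
  have hF' := (hF.iterate hq).reindex e
  simp only [he] at hF'
  exact lipEquiv_of_same hE' hF'
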